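/- In the Heisenberg group 𝔥 = ℝ³, let d_F be the Finsler distance associated with the norm ‖u‖ := max(√(u₁²+u₂²), |u₃|), and let μ be the Lebesgue measure on ℝ³ (a Haar measure of the group). Then there exist C, D > 0 such that μ({q ∈ ℝ³ : d_F(0,q) ≤ r}) = C·r⁴ + D·r³ for every r ≥ 0. -/

import Mathlib

open MeasureTheory

/-- The Heisenberg group modeled on `ℝ³`. -/
abbrev Heis : Type := ℝ × ℝ × ℝ

/-- The Heisenberg Lie bracket `⁅(a,b,c),(a',b',c')⁆ = (0,0,ab'−a'b)`. -/
def hbracket (x y : Heis) : Heis := (0, 0, x.1 * y.2.1 - y.1 * x.2.1)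

/-- The Heisenberg group product `x∗y = x + y + (1/2)⁅x,y⁆`. -/
noncomputable def hmul (x y : Heis) : Heis := x + y + (2⁻¹ : ℝ) • hbracket x y

/-- The endpoint `E(u) = ∫₀¹ u + (1/2)∫₀¹ ⁅∫₀ᵗ u, u(t)⁆ dt` of the curve with control `u`. -/
noncomputable def hEndpoint (u : ℝ → Heis) : Heis :=
  (∫ t in (0:ℝ)..1, u t) +
    (2⁻¹ : ℝ) • ∫ t in (0:ℝ)..1, hbracket (∫ s in (0:ℝ)..t, u s) (u t)

/-- The sub-Riemannian distance on the Heisenberg group: infimum of `∫₀¹ √(u₁²+u₂²)` over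
`L¹` controls `u` with `u₃ = 0` a.e. steering `p` to `q`. -/
noncomputable def dH (p q : Heis) : ℝ :=
  sInf {l : ℝ | ∃ u : ℝ → Heis, IntervalIntegrable u volume 0 1 ∧
    (∀ᵐ t ∂(volume.restrict (Set.Icc (0:ℝ) 1)), (u t).2.2 = 0) ∧
    hEndpoint u = hmul (-p) q ∧
    l = ∫ t in (0:ℝ)..1, Real.sqrt ((u t).1 ^ 2 + (u t).2.1 ^ 2)}

/-- The Finsler distance associated with a norm `nrm` on `ℝ³`: infimum of `∫₀¹ nrm (u t)`
over `L¹` controls `u` steering `p` to `q`. -/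
noncomputable def dFin (nrm : Heis → ℝ) (p q : Heis) : ℝ :=
  sInf {l : ℝ | ∃ u : ℝ → Heis, IntervalIntegrable u volume 0 1 ∧
    hEndpoint u = hmul (-p) q ∧
    l = ∫ t in (0:ℝ)..1, nrm (u t)}

open intervalIntegral

/-- The symplectic area swept by the planar curve with velocity `(f, g)` on `[0, 1]`. -/
noncomputable def sweptArea (f g : ℝ → ℝ) : ℝ :=
  2⁻¹ * ∫ t in (0:ℝ)..1, ((∫ s in (0:ℝ)..t, f s) * g t - f t * ∫ s in (0:ℝ)..t, g s)

/-- `Reach L x y z`: some planar curve of length less than `L` goes from `0` to `(x, y)`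
and sweeps the area `z`. -/
def Reach (L x y z : ℝ) : Prop :=
  ∃ f g : ℝ → ℝ, IntervalIntegrable f volume 0 1 ∧ IntervalIntegrable g volume 0 1 ∧
    ∫ t in (0:ℝ)..1, f t = x ∧ ∫ t in (0:ℝ)..1, g t = y ∧ sweptArea f g = z ∧
    ∫ t in (0:ℝ)..1, Real.sqrt (f t ^ 2 + g t ^ 2) < L

lemma sqrt_add_sq_le_abs_add_abs (a b : ℝ) : Real.sqrt (a ^ 2 + b ^ 2) ≤ |a| + |b| := by
  rw [Real.sqrt_le_left (by positivity)]
  nlinarith [sq_abs a, sq_abs b, abs_nonneg a, abs_nonneg b, mul_nonneg (abs_nonneg a) (abs_nonneg b)]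

lemma abs_le_sqrt_add_sq_left (a b : ℝ) : |a| ≤ Real.sqrt (a ^ 2 + b ^ 2) :=
  Real.abs_le_sqrt (by nlinarith [sq_nonneg b])

lemma abs_le_sqrt_add_sq_right (a b : ℝ) : |b| ≤ Real.sqrt (a ^ 2 + b ^ 2) :=
  Real.abs_le_sqrt (by nlinarith [sq_nonneg a])

lemma sqrt_add_sq_triangle (a b c d : ℝ) :
    Real.sqrt ((a + c) ^ 2 + (b + d) ^ 2) ≤ Real.sqrt (a ^ 2 + b ^ 2) + (|c| + |d|) := by
  rw [Real.sqrt_le_left (by positivity)]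
  have h1 := Real.sq_sqrt (show 0 ≤ a ^ 2 + b ^ 2 by positivity)
  have h2 := abs_le_sqrt_add_sq_left a b
  have h3 := abs_le_sqrt_add_sq_right a b
  have h4 : a * c ≤ Real.sqrt (a ^ 2 + b ^ 2) * |c| := by
    calc a * c ≤ |a * c| := le_abs_self _
      _ = |a| * |c| := abs_mul _ _
      _ ≤ _ := by gcongr
  have h5 : b * d ≤ Real.sqrt (a ^ 2 + b ^ 2) * |d| := by
    calc b * d ≤ |b * d| := le_abs_self _
      _ = |b| * |d| := abs_mul _ _
      _ ≤ _ := by gcongr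
  nlinarith [sq_abs c, sq_abs d, mul_nonneg (abs_nonneg c) (abs_nonneg d)]

lemma intervalIntegrable_sqrt_add_sq {f g : ℝ → ℝ} (hf : IntervalIntegrable f volume 0 1)
    (hg : IntervalIntegrable g volume 0 1) :
    IntervalIntegrable (fun t => Real.sqrt (f t ^ 2 + g t ^ 2)) volume 0 1 := by
  refine (hf.abs.add hg.abs).mono_fun' ?_ (Filter.Eventually.of_forall fun t => ?_)
  · exact Real.continuous_sqrt.comp_aestronglyMeasurable
      ((hf.def'.1.pow 2).add (hg.def'.1.pow 2))
  · simp only [Real.norm_eq_abs, abs_of_nonneg (Real.sqrt_nonneg _)]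
    exact sqrt_add_sq_le_abs_add_abs _ _

lemma continuousOn_primitive {f : ℝ → ℝ} (hf : IntervalIntegrable f volume 0 1) :
    ContinuousOn (fun t => ∫ s in (0:ℝ)..t, f s) (Set.uIcc 0 1) :=
  continuousOn_primitive_interval' hf Set.left_mem_uIcc

lemma intervalIntegrable_primitive_mul {f g : ℝ → ℝ} (hf : IntervalIntegrable f volume 0 1)
    (hg : IntervalIntegrable g volume 0 1) :
    IntervalIntegrable (fun t => (∫ s in (0:ℝ)..t, f s) * g t) volume 0 1 :=
  hg.continuousOn_mul (continuousOn_primitive hf)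

lemma intervalIntegrable_mul_primitive {f g : ℝ → ℝ} (hf : IntervalIntegrable f volume 0 1)
    (hg : IntervalIntegrable g volume 0 1) :
    IntervalIntegrable (fun t => f t * ∫ s in (0:ℝ)..t, g s) volume 0 1 :=
  hf.mul_continuousOn (continuousOn_primitive hg)

lemma intervalIntegrable_zero_of_mem {f : ℝ → ℝ} {t : ℝ} (hf : IntervalIntegrable f volume 0 1)
    (ht : t ∈ Set.uIcc (0:ℝ) 1) : IntervalIntegrable f volume 0 t :=
  hf.mono_set (Set.uIcc_subset_uIcc Set.left_mem_uIcc ht)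

lemma intervalIntegral_fst {E F : Type*} [NormedAddCommGroup E] [NormedSpace ℝ E] [CompleteSpace E]
    [NormedAddCommGroup F] [NormedSpace ℝ F] [CompleteSpace F] {u : ℝ → E × F} {a b : ℝ}
    (hu : IntervalIntegrable u volume a b) : (∫ t in a..b, u t).1 = ∫ t in a..b, (u t).1 :=
  ((ContinuousLinearMap.fst ℝ E F).intervalIntegral_comp_comm hu).symm

lemma intervalIntegral_snd {E F : Type*} [NormedAddCommGroup E] [NormedSpace ℝ E] [CompleteSpace E]
    [NormedAddCommGroup F] [NormedSpace ℝ F] [CompleteSpace F] {u : ℝ → E × F} {a b : ℝ}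
    (hu : IntervalIntegrable u volume a b) : (∫ t in a..b, u t).2 = ∫ t in a..b, (u t).2 :=
  ((ContinuousLinearMap.snd ℝ E F).intervalIntegral_comp_comm hu).symm

lemma intervalIntegrable_prodMk {E F : Type*} [NormedAddCommGroup E] [NormedAddCommGroup F]
    {f : ℝ → E} {g : ℝ → F} {a b : ℝ} (hf : IntervalIntegrable f volume a b)
    (hg : IntervalIntegrable g volume a b) :
    IntervalIntegrable (fun t => (f t, g t)) volume a b :=
  ⟨hf.1.prodMk hg.1, hf.2.prodMk hg.2⟩

lemma intervalIntegrable_fst {E F : Type*} [NormedAddCommGroup E] [NormedSpace ℝ E]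
    [NormedAddCommGroup F] [NormedSpace ℝ F]
    {u : ℝ → E × F} {a b : ℝ} (hu : IntervalIntegrable u volume a b) :
    IntervalIntegrable (fun t => (u t).1) volume a b := ⟨hu.1.fst, hu.2.fst⟩

lemma intervalIntegrable_snd {E F : Type*} [NormedAddCommGroup E] [NormedSpace ℝ E]
    [NormedAddCommGroup F] [NormedSpace ℝ F]
    {u : ℝ → E × F} {a b : ℝ} (hu : IntervalIntegrable u volume a b) :
    IntervalIntegrable (fun t => (u t).2) volume a b := ⟨hu.1.snd, hu.2.snd⟩

lemma hEndpoint_eq {f g w : ℝ → ℝ} (hf : IntervalIntegrable f volume 0 1)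
    (hg : IntervalIntegrable g volume 0 1) (hw : IntervalIntegrable w volume 0 1) :
    hEndpoint (fun t => (f t, g t, w t)) = (∫ t in (0:ℝ)..1, f t, ∫ t in (0:ℝ)..1, g t,
      (∫ t in (0:ℝ)..1, w t) + sweptArea f g) := by
  have hgw := intervalIntegrable_prodMk hg hw
  have hu := intervalIntegrable_prodMk hf hgw
  have hI : ∀ t ∈ Set.uIcc (0:ℝ) 1, ∫ s in (0:ℝ)..t, ((f s, g s, w s) : Heis) =
      (∫ s in (0:ℝ)..t, f s, ∫ s in (0:ℝ)..t, g s, ∫ s in (0:ℝ)..t, w s) := by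
    intro t ht
    have hs : Set.uIcc 0 t ⊆ Set.uIcc (0:ℝ) 1 := Set.uIcc_subset_uIcc Set.left_mem_uIcc ht
    refine Prod.ext ?_ (Prod.ext ?_ ?_)
    · rw [intervalIntegral_fst (hu.mono_set hs)]
    · rw [intervalIntegral_snd (hu.mono_set hs), intervalIntegral_fst (hgw.mono_set hs)]
    · rw [intervalIntegral_snd (hu.mono_set hs), intervalIntegral_snd (hgw.mono_set hs)]
  have hB : IntervalIntegrable (fun t => (∫ s in (0:ℝ)..t, f s) * g t -
      f t * ∫ s in (0:ℝ)..t, g s) volume 0 1 :=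
    (intervalIntegrable_primitive_mul hf hg).sub (intervalIntegrable_mul_primitive hf hg)
  have h0 : IntervalIntegrable (fun _ => (0:ℝ)) volume 0 1 := intervalIntegrable_const
  have hJ : ∫ t in (0:ℝ)..1, hbracket (∫ s in (0:ℝ)..t, ((f s, g s, w s) : Heis)) (f t, g t, w t) =
      (0, 0, ∫ t in (0:ℝ)..1, ((∫ s in (0:ℝ)..t, f s) * g t - f t * ∫ s in (0:ℝ)..t, g s)) := by
    rw [integral_congr (g := fun t => ((0, 0, (∫ s in (0:ℝ)..t, f s) * g t -
      f t * ∫ s in (0:ℝ)..t, g s) : Heis))]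
    · have h2 := intervalIntegrable_prodMk h0 hB
      have h3 := intervalIntegrable_prodMk h0 h2
      refine Prod.ext ?_ (Prod.ext ?_ ?_)
      · rw [intervalIntegral_fst h3]; simp
      · rw [intervalIntegral_snd h3, intervalIntegral_fst h2]; simp
      · rw [intervalIntegral_snd h3, intervalIntegral_snd h2]
    · intro t ht
      simp only [hI t ht, hbracket]
  unfold hEndpoint
  rw [hJ, hI 1 Set.right_mem_uIcc]
  simp [sweptArea]

lemma reach_linear {L x y z k a b c d : ℝ} (hk : 0 < k)
    (hM : ∀ s t : ℝ, Real.sqrt ((a * s + b * t) ^ 2 + (c * s + d * t) ^ 2) ≤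
      k * Real.sqrt (s ^ 2 + t ^ 2)) (h : Reach L x y z) :
    Reach (k * L) (a * x + b * y) (c * x + d * y) ((a * d - b * c) * z) := by
  obtain ⟨f, g, hf, hg, hx, hy, hz, hL⟩ := h
  have hlin : ∀ (p q : ℝ), ∀ t ∈ Set.uIcc (0:ℝ) 1, ∫ s in (0:ℝ)..t, (p * f s + q * g s) =
      p * (∫ s in (0:ℝ)..t, f s) + q * ∫ s in (0:ℝ)..t, g s := by
    intro p q t ht
    rw [integral_add ((intervalIntegrable_zero_of_mem hf ht).const_mul p)
      ((intervalIntegrable_zero_of_mem hg ht).const_mul q), intervalIntegral.integral_const_mul,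
      intervalIntegral.integral_const_mul]
  have hf' : IntervalIntegrable (fun t => a * f t + b * g t) volume 0 1 :=
    (hf.const_mul a).add (hg.const_mul b)
  have hg' : IntervalIntegrable (fun t => c * f t + d * g t) volume 0 1 :=
    (hf.const_mul c).add (hg.const_mul d)
  refine ⟨fun t => a * f t + b * g t, fun t => c * f t + d * g t, hf', hg', ?_, ?_, ?_, ?_⟩
  · rw [hlin a b 1 Set.right_mem_uIcc, hx, hy]
  · rw [hlin c d 1 Set.right_mem_uIcc, hx, hy]
  · rw [← hz, sweptArea, sweptArea, mul_left_comm (a * d - b * c),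
      ← intervalIntegral.integral_const_mul (a * d - b * c)]
    congr 1
    refine integral_congr (g := fun t => (a * d - b * c) * ((∫ s in (0:ℝ)..t, f s) * g t -
      f t * ∫ s in (0:ℝ)..t, g s)) fun t ht => ?_
    simp only [hlin _ _ t ht]
    ring
  · calc _ ≤ ∫ t in (0:ℝ)..1, k * Real.sqrt (f t ^ 2 + g t ^ 2) :=
        integral_mono zero_le_one (intervalIntegrable_sqrt_add_sq hf' hg')
          ((intervalIntegrable_sqrt_add_sq hf hg).const_mul k) fun t => hM _ _
      _ < k * L := by
        rw [intervalIntegral.integral_const_mul]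
        gcongr

lemma Reach.smul {L x y z k : ℝ} (hk : 0 < k) (h : Reach L x y z) :
    Reach (k * L) (k * x) (k * y) (k ^ 2 * z) := by
  have := reach_linear (a := k) (b := 0) (c := 0) (d := k) hk (fun s t => ?_) h
  · convert this using 1 <;> ring
  · rw [show (k * s + 0 * t) ^ 2 + (0 * s + k * t) ^ 2 = k ^ 2 * (s ^ 2 + t ^ 2) by ring,
      Real.sqrt_mul (by positivity), Real.sqrt_sq hk.le]

lemma exists_unit_vector (x y : ℝ) : ∃ a b r : ℝ, a ^ 2 + b ^ 2 = 1 ∧ x = r * a ∧ y = r * b := by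
  rcases eq_or_ne (x ^ 2 + y ^ 2) 0 with h | h
  · have hx : x = 0 := by nlinarith [sq_nonneg x, sq_nonneg y]
    have hy : y = 0 := by nlinarith [sq_nonneg x, sq_nonneg y]
    exact ⟨1, 0, 0, by simp, by simp [hx], by simp [hy]⟩
  · have hp : 0 < x ^ 2 + y ^ 2 := lt_of_le_of_ne (by positivity) h.symm
    have hs := Real.sqrt_pos.2 hp
    refine ⟨x / Real.sqrt (x ^ 2 + y ^ 2), y / Real.sqrt (x ^ 2 + y ^ 2),
      Real.sqrt (x ^ 2 + y ^ 2), ?_, by field_simp, by field_simp⟩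
    rw [div_pow, div_pow, Real.sq_sqrt hp.le, ← add_div, div_self h]

/-- Shrinking a curve orthogonally to its chord scales the swept area. -/
lemma Reach.mul_area {L x y z l : ℝ} (hl : |l| ≤ 1) (h : Reach L x y z) : Reach L x y (l * z) := by
  obtain ⟨a, b, r, hab, hx, hy⟩ := exists_unit_vector x y
  have hl2 : l ^ 2 ≤ 1 := by rwa [sq_le_one_iff_abs_le_one]
  have := reach_linear (a := a ^ 2 + l * b ^ 2) (b := (1 - l) * (a * b)) (c := (1 - l) * (a * b))
    (d := b ^ 2 + l * a ^ 2) one_pos (fun s t => ?_) h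
  · convert this using 1
    · ring
    · rw [hx, hy]; linear_combination (-r * a) * hab
    · rw [hx, hy]; linear_combination (-r * b) * hab
    · linear_combination (-z * l * (a ^ 2 + b ^ 2 + 1)) * hab
  · rw [one_mul]
    apply Real.sqrt_le_sqrt
    have e1 : ((a ^ 2 + l * b ^ 2) * s + (1 - l) * (a * b) * t) ^ 2 +
        ((1 - l) * (a * b) * s + (b ^ 2 + l * a ^ 2) * t) ^ 2 =
        ((a * s + b * t) ^ 2 + l ^ 2 * (b * s - a * t) ^ 2) * (a ^ 2 + b ^ 2) := by ring
    have e2 : s ^ 2 + t ^ 2 = (a * s + b * t) ^ 2 + (b * s - a * t) ^ 2 := by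
      linear_combination (-(s ^ 2 + t ^ 2)) * hab
    rw [e1, e2, hab, mul_one]
    nlinarith [sq_nonneg (b * s - a * t)]

lemma Reach.of_abs_le {L x y z z' : ℝ} (h : Reach L x y z) (hz : |z'| ≤ |z|) :
    Reach L x y z' := by
  rcases eq_or_ne z 0 with h0 | h0
  · have : z' = 0 := by simpa [h0] using hz
    rwa [this, ← h0]
  · have := h.mul_area (l := z' / z) (by
      rw [abs_div]; exact div_le_one_of_le₀ hz (abs_nonneg _))
    rwa [div_mul_cancel₀ _ h0] at this

lemma reach_segment {L x y : ℝ} (h : Real.sqrt (x ^ 2 + y ^ 2) < L) : Reach L x y 0 := by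
  refine ⟨fun _ => x, fun _ => y, intervalIntegrable_const, intervalIntegrable_const, by simp,
    by simp, ?_, by simpa using h⟩
  rw [sweptArea, integral_congr (g := fun _ => (0:ℝ)) fun t _ => ?_]
  · simp
  · simp only [intervalIntegral.integral_const, smul_eq_mul]
    ring

lemma Reach.sqrt_lt {L x y z : ℝ} (h : Reach L x y z) : Real.sqrt (x ^ 2 + y ^ 2) < L := by
  obtain ⟨f, g, hf, hg, hx, hy, hz, hL⟩ := h
  refine lt_of_le_of_lt ?_ hL
  have h1 : ∫ t in (0:ℝ)..1, (x * f t + y * g t) = x ^ 2 + y ^ 2 := by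
    rw [integral_add (hf.const_mul x) (hg.const_mul y), intervalIntegral.integral_const_mul,
      intervalIntegral.integral_const_mul, hx, hy]
    ring
  have h2 : ∫ t in (0:ℝ)..1, (x * f t + y * g t) ≤
      ∫ t in (0:ℝ)..1, Real.sqrt (x ^ 2 + y ^ 2) * Real.sqrt (f t ^ 2 + g t ^ 2) := by
    refine integral_mono zero_le_one ((hf.const_mul x).add (hg.const_mul y))
      ((intervalIntegrable_sqrt_add_sq hf hg).const_mul _) fun t => ?_
    rw [← Real.sqrt_mul (by positivity)]
    refine Real.le_sqrt_of_sq_le ?_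
    nlinarith [sq_nonneg (x * g t - y * f t)]
  rw [intervalIntegral.integral_const_mul, h1] at h2
  rcases (Real.sqrt_nonneg (x ^ 2 + y ^ 2)).eq_or_lt with h0 | h0
  · rw [← h0]
    exact integral_nonneg zero_le_one fun t _ => Real.sqrt_nonneg _
  · have h3 := Real.mul_self_sqrt (show 0 ≤ x ^ 2 + y ^ 2 by positivity)
    exact le_of_mul_le_mul_left (by linarith) h0

lemma abs_primitive_le {f h : ℝ → ℝ} (hf : IntervalIntegrable f volume 0 1)
    (hh : IntervalIntegrable h volume 0 1) (hfh : ∀ t, |f t| ≤ h t) {t : ℝ}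
    (ht : t ∈ Set.Icc (0:ℝ) 1) : |∫ s in (0:ℝ)..t, f s| ≤ ∫ s in (0:ℝ)..1, h s := by
  have ht' : t ∈ Set.uIcc (0:ℝ) 1 := by rwa [Set.uIcc_of_le zero_le_one]
  calc |∫ s in (0:ℝ)..t, f s| ≤ ∫ s in (0:ℝ)..t, |f s| := abs_integral_le_integral_abs ht.1
    _ ≤ ∫ s in (0:ℝ)..t, h s := integral_mono ht.1 (intervalIntegrable_zero_of_mem hf ht').abs
        (intervalIntegrable_zero_of_mem hh ht') hfh
    _ ≤ ∫ s in (0:ℝ)..1, h s := integral_mono_interval le_rfl ht.1 ht.2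
        (Filter.Eventually.of_forall fun s => (abs_nonneg _).trans (hfh s)) hh

lemma Reach.area_le {L x y z : ℝ} (h : Reach L x y z) : z ≤ L ^ 2 := by
  obtain ⟨f, g, hf, hg, hx, hy, hz, hL⟩ := h
  set n : ℝ → ℝ := fun t => Real.sqrt (f t ^ 2 + g t ^ 2) with hn
  have hni : IntervalIntegrable n volume 0 1 := intervalIntegrable_sqrt_add_sq hf hg
  have hfn : ∀ t, |f t| ≤ n t := fun t => abs_le_sqrt_add_sq_left _ _
  have hgn : ∀ t, |g t| ≤ n t := fun t => abs_le_sqrt_add_sq_right _ _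
  set l := ∫ t in (0:ℝ)..1, n t with hl
  have hl0 : 0 ≤ l := integral_nonneg zero_le_one fun t _ => Real.sqrt_nonneg _
  have key : ∫ t in (0:ℝ)..1, ((∫ s in (0:ℝ)..t, f s) * g t - f t * ∫ s in (0:ℝ)..t, g s) ≤
      ∫ t in (0:ℝ)..1, (2 * l) * n t := by
    refine integral_mono_on zero_le_one ((intervalIntegrable_primitive_mul hf hg).sub
      (intervalIntegrable_mul_primitive hf hg)) (hni.const_mul _) fun t ht => ?_
    have h1 : (∫ s in (0:ℝ)..t, f s) * g t ≤ l * n t := by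
      refine (le_abs_self _).trans ?_
      rw [abs_mul]
      exact mul_le_mul (abs_primitive_le hf hni hfn ht) (hgn t) (abs_nonneg _) hl0
    have h2 : -(f t * ∫ s in (0:ℝ)..t, g s) ≤ l * n t := by
      refine (neg_le_abs _).trans ?_
      rw [abs_mul, mul_comm]
      exact mul_le_mul (abs_primitive_le hg hni hgn ht) (hfn t) (abs_nonneg _) hl0
    linarith
  rw [intervalIntegral.integral_const_mul, ← hl] at key
  rw [← hz, sweptArea]
  nlinarith

/-- Adding a small constant velocity moves the endpoint freely and the area affinely. -/
lemma Reach.exists_translate {L x y z : ℝ} (h : Reach L x y z) :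
    ∃ p q η : ℝ, 0 < η ∧ ∀ a b : ℝ, |a| + |b| < η → Reach L (x + a) (y + b) (z + p * a + q * b) := by
  obtain ⟨f, g, hf, hg, hx, hy, hz, hL⟩ := h
  refine ⟨2⁻¹ * ∫ t in (0:ℝ)..1, (t * g t - ∫ s in (0:ℝ)..t, g s),
    2⁻¹ * ∫ t in (0:ℝ)..1, ((∫ s in (0:ℝ)..t, f s) - f t * t),
    L - ∫ t in (0:ℝ)..1, Real.sqrt (f t ^ 2 + g t ^ 2), by linarith, fun a b hab => ?_⟩
  have hc : ∀ c : ℝ, IntervalIntegrable (fun _ => c) volume 0 1 :=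
    fun c => intervalIntegrable_const
  have hfa := hf.add (hc a)
  have hgb := hg.add (hc b)
  have hlin : ∀ {h : ℝ → ℝ} (c : ℝ), IntervalIntegrable h volume 0 1 → ∀ t ∈ Set.uIcc (0:ℝ) 1,
      ∫ s in (0:ℝ)..t, (h s + c) = (∫ s in (0:ℝ)..t, h s) + t * c := by
    intro h c hh t ht
    rw [integral_add (intervalIntegrable_zero_of_mem hh ht) intervalIntegrable_const,
      intervalIntegral.integral_const]
    simp
  refine ⟨fun t => f t + a, fun t => g t + b, hfa, hgb, ?_, ?_, ?_, ?_⟩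
  · rw [hlin a hf 1 Set.right_mem_uIcc, hx, one_mul]
  · rw [hlin b hg 1 Set.right_mem_uIcc, hy, one_mul]
  · have i1 : IntervalIntegrable (fun t => t * g t - ∫ s in (0:ℝ)..t, g s) volume 0 1 :=
      (hg.continuousOn_mul continuousOn_id).sub (continuousOn_primitive hg).intervalIntegrable
    have i2 : IntervalIntegrable (fun t => (∫ s in (0:ℝ)..t, f s) - f t * t) volume 0 1 :=
      (continuousOn_primitive hf).intervalIntegrable.sub (hf.mul_continuousOn continuousOn_id)
    have i0 := (intervalIntegrable_primitive_mul hf hg).sub (intervalIntegrable_mul_primitive hf hg)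
    rw [← hz, sweptArea, sweptArea,
      integral_congr (g := fun t => ((∫ s in (0:ℝ)..t, f s) * g t - f t * ∫ s in (0:ℝ)..t, g s) +
        a * (t * g t - ∫ s in (0:ℝ)..t, g s) + b * ((∫ s in (0:ℝ)..t, f s) - f t * t))
        (fun t ht => by simp only [hlin _ hf t ht, hlin _ hg t ht]; ring),
      integral_add (i0.add (i1.const_mul a)) (i2.const_mul b), integral_add i0 (i1.const_mul a),
      intervalIntegral.integral_const_mul, intervalIntegral.integral_const_mul]
    ring
  · have hn := intervalIntegrable_sqrt_add_sq hf hg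
    calc _ ≤ ∫ t in (0:ℝ)..1, (Real.sqrt (f t ^ 2 + g t ^ 2) + (|a| + |b|)) :=
        integral_mono zero_le_one (intervalIntegrable_sqrt_add_sq hfa hgb) (hn.add (hc _))
          fun t => sqrt_add_sq_triangle _ _ _ _
      _ < L := by
        rw [integral_add hn (hc _), intervalIntegral.integral_const]
        simp only [sub_zero, one_smul]
        linarith

lemma exists_reach_zero_zero_pos : ∃ z > 0, Reach 1 0 0 z := by
  set f : ℝ → ℝ := fun t => (1 - 6 * t + 6 * t ^ 2) / 4 with hf
  set g : ℝ → ℝ := fun t => (1 - 2 * t) / 4 with hg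
  have hfi : IntervalIntegrable f volume 0 1 := (by fun_prop : Continuous f).intervalIntegrable 0 1
  have hgi : IntervalIntegrable g volume 0 1 := (by fun_prop : Continuous g).intervalIntegrable 0 1
  have hF : ∀ t, ∫ s in (0:ℝ)..t, f s = (t - 3 * t ^ 2 + 2 * t ^ 3) / 4 := by
    intro t
    have := integral_eq_sub_of_hasDerivAt (a := 0) (b := t)
      (f := fun t : ℝ => (t - 3 * t ^ 2 + 2 * t ^ 3) / 4) (f' := f) (fun s _ => by
        refine ((((hasDerivAt_id s).sub ((hasDerivAt_pow 2 s).const_mul 3)).add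
          ((hasDerivAt_pow 3 s).const_mul 2)).div_const 4).congr_deriv ?_
        norm_num [hf]; ring) ((by fun_prop : Continuous f).intervalIntegrable 0 t)
    simpa using this
  have hG : ∀ t, ∫ s in (0:ℝ)..t, g s = (t - t ^ 2) / 4 := by
    intro t
    have := integral_eq_sub_of_hasDerivAt (a := 0) (b := t)
      (f := fun t : ℝ => (t - t ^ 2) / 4) (f' := g) (fun s _ => by
        refine (((hasDerivAt_id s).sub (hasDerivAt_pow 2 s)).div_const 4).congr_deriv ?_
        simp [hg]) ((by fun_prop : Continuous g).intervalIntegrable 0 t)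
    simpa using this
  refine ⟨sweptArea f g, ?_, f, g, hfi, hgi, by rw [hF]; norm_num, by rw [hG]; norm_num, rfl, ?_⟩
  · simp only [sweptArea, hF, hG]
    refine mul_pos (by norm_num) (intervalIntegral_pos_of_pos_on ?_ (fun t ht => ?_) one_pos)
    · exact Continuous.intervalIntegrable (by fun_prop) 0 1
    · have h1 := ht.1
      have h2 : 0 < 1 - t := by linarith [ht.2]
      have : (t - 3 * t ^ 2 + 2 * t ^ 3) / 4 * g t - f t * ((t - t ^ 2) / 4) =
          (t * (1 - t)) ^ 2 / 8 := by simp only [hf, hg]; ring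
      rw [this]
      positivity
  · calc _ ≤ ∫ t in (0:ℝ)..1, (1 / 2 : ℝ) := by
          refine integral_mono_on zero_le_one (intervalIntegrable_sqrt_add_sq hfi hgi)
            intervalIntegrable_const fun t ht => ?_
          refine (sqrt_add_sq_le_abs_add_abs _ _).trans ?_
          have h1 : |f t| ≤ 1 / 4 := by
            rw [abs_le]; constructor <;> simp only [hf] <;>
              nlinarith [ht.1, ht.2, sq_nonneg (2 * t - 1)]
          have h2 : |g t| ≤ 1 / 4 := by
            rw [abs_le]; constructor <;> simp only [hg] <;> linarith [ht.1, ht.2]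
          linarith
      _ < 1 := by simp; norm_num

lemma setOf_cost_nonempty (nrm : Heis → ℝ) (p q : Heis) :
    {l : ℝ | ∃ u : ℝ → Heis, IntervalIntegrable u volume 0 1 ∧
      hEndpoint u = hmul (-p) q ∧ l = ∫ t in (0:ℝ)..1, nrm (u t)}.Nonempty := by
  refine ⟨_, fun _ => hmul (-p) q, intervalIntegrable_const, ?_, rfl⟩
  have : ∀ t : ℝ, hbracket (t • hmul (-p) q) (hmul (-p) q) = 0 := by
    intro t
    refine Prod.ext rfl (Prod.ext rfl ?_)
    simp only [hbracket, Prod.smul_fst, Prod.smul_snd, smul_eq_mul]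
    simp only [Prod.snd_zero]
    ring
  simp only [hEndpoint, intervalIntegral.integral_const, sub_zero, this, smul_zero, one_smul,
    add_zero]

/-- The `ℓ^∞`-type norm `max(√(u₁²+u₂²), |u₃|)`. -/
noncomputable def maxNorm (u : Heis) : ℝ := max (Real.sqrt (u.1 ^ 2 + u.2.1 ^ 2)) |u.2.2|

lemma maxNorm_nonneg (u : Heis) : 0 ≤ maxNorm u := le_max_of_le_right (abs_nonneg _)

lemma intervalIntegrable_maxNorm {f g w : ℝ → ℝ} (hf : IntervalIntegrable f volume 0 1)
    (hg : IntervalIntegrable g volume 0 1) (hw : IntervalIntegrable w volume 0 1) :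
    IntervalIntegrable (fun t => maxNorm (f t, g t, w t)) volume 0 1 := by
  have hn := intervalIntegrable_sqrt_add_sq hf hg
  exact ⟨hn.1.sup hw.abs.1, hn.2.sup hw.abs.2⟩

lemma dFin_maxNorm_lt_iff {L : ℝ} {q : Heis} :
    dFin maxNorm 0 q < L ↔ ∃ c, |c| < L ∧ Reach L q.1 q.2.1 (q.2.2 - c) := by
  have hq : hmul (-0) q = q := by
    refine Prod.ext ?_ (Prod.ext ?_ ?_) <;> simp [hmul, hbracket]
  have hbdd : BddBelow {l : ℝ | ∃ u : ℝ → Heis, IntervalIntegrable u volume 0 1 ∧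
      hEndpoint u = hmul (-0) q ∧ l = ∫ t in (0:ℝ)..1, maxNorm (u t)} := by
    refine ⟨0, ?_⟩
    rintro l ⟨u, -, -, rfl⟩
    exact integral_nonneg zero_le_one fun t _ => maxNorm_nonneg _
  rw [dFin, csInf_lt_iff hbdd (setOf_cost_nonempty maxNorm 0 q), hq]
  constructor
  · rintro ⟨l, ⟨u, hu, hE, rfl⟩, hl⟩
    have hf := intervalIntegrable_fst hu
    have hg := intervalIntegrable_fst (intervalIntegrable_snd hu)
    have hw := intervalIntegrable_snd (intervalIntegrable_snd hu)
    have hm := intervalIntegrable_maxNorm hf hg hw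
    have hE' := hEndpoint_eq hf hg hw
    rw [show (fun t => ((u t).1, (u t).2.1, (u t).2.2)) = u from rfl, hE] at hE'
    refine ⟨∫ t in (0:ℝ)..1, (u t).2.2, ?_, fun t => (u t).1, fun t => (u t).2.1, hf, hg, ?_, ?_,
      ?_, ?_⟩
    · refine lt_of_le_of_lt ((abs_integral_le_integral_abs zero_le_one).trans ?_) hl
      exact integral_mono zero_le_one hw.abs hm fun t => le_max_right _ _
    · rw [hE']
    · rw [hE']
    · rw [hE']; simp
    · refine lt_of_le_of_lt ?_ hl
      exact integral_mono zero_le_one (intervalIntegrable_sqrt_add_sq hf hg) hm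
        fun t => le_max_left _ _
  · rintro ⟨c, hc, f, g, hf, hg, hx, hy, hz, hL⟩
    have hn := intervalIntegrable_sqrt_add_sq hf hg
    set l := ∫ t in (0:ℝ)..1, Real.sqrt (f t ^ 2 + g t ^ 2) with hl
    have hl0 : 0 ≤ l := integral_nonneg zero_le_one fun t _ => Real.sqrt_nonneg _
    obtain ⟨m, hm, hmL⟩ := exists_between (max_lt hL hc)
    obtain ⟨hlm, hcm⟩ := max_lt_iff.1 hm
    have hm0 : 0 < m := hl0.trans_lt hlm
    have hs : IntervalIntegrable (fun t => Real.sqrt (f t ^ 2 + g t ^ 2) + (m - l)) volume 0 1 :=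
      hn.add intervalIntegrable_const
    have hsI : ∫ t in (0:ℝ)..1, (Real.sqrt (f t ^ 2 + g t ^ 2) + (m - l)) = m := by
      rw [integral_add hn intervalIntegrable_const, ← hl]
      simp
    have hw := hs.const_mul (c / m)
    refine ⟨_, ⟨fun t => (f t, g t, c / m * (Real.sqrt (f t ^ 2 + g t ^ 2) + (m - l))),
      intervalIntegrable_prodMk hf (intervalIntegrable_prodMk hg hw), ?_, rfl⟩, ?_⟩
    · rw [hEndpoint_eq hf hg hw, intervalIntegral.integral_const_mul, hsI, hx, hy, hz,
        div_mul_cancel₀ _ hm0.ne']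
      simp
    · refine lt_of_le_of_lt ?_ hmL
      conv_rhs => rw [← hsI]
      refine integral_mono zero_le_one (intervalIntegrable_maxNorm hf hg hw) hs fun t => ?_
      have h0 : 0 ≤ Real.sqrt (f t ^ 2 + g t ^ 2) + (m - l) :=
        add_nonneg (Real.sqrt_nonneg _) (by linarith)
      refine max_le (by simp only; linarith) ?_
      simp only
      rw [abs_mul, abs_of_nonneg h0, abs_div, abs_of_pos hm0]
      exact mul_le_of_le_one_left h0 ((div_le_one hm0).2 hcm.le)

/-- The largest area swept by curves of length less than one from `0` to `p`. -/
noncomputable def maxArea (p : ℝ × ℝ) : ℝ := sSup {z | Reach 1 p.1 p.2 z}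

/-- The open Euclidean disc of radius `L` in `ℝ × ℝ`. -/
def disc (L : ℝ) : Set (ℝ × ℝ) := {p | Real.sqrt (p.1 ^ 2 + p.2 ^ 2) < L}

lemma bddAbove_reach (L x y : ℝ) : BddAbove {z | Reach L x y z} := ⟨L ^ 2, fun _ h => h.area_le⟩

lemma maxArea_le_one (p : ℝ × ℝ) : maxArea p ≤ 1 :=
  Real.sSup_le (fun z h => by simpa using Reach.area_le h) zero_le_one

lemma Reach.le_maxArea {x y z : ℝ} (h : Reach 1 x y z) : z ≤ maxArea (x, y) :=
  le_csSup (bddAbove_reach 1 x y) h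

lemma maxArea_nonneg (p : ℝ × ℝ) : 0 ≤ maxArea p := by
  by_cases h : Real.sqrt (p.1 ^ 2 + p.2 ^ 2) < 1
  · exact (reach_segment h).le_maxArea
  · have : {z | Reach 1 p.1 p.2 z} = ∅ :=
      Set.eq_empty_of_forall_notMem fun z hz => h (Reach.sqrt_lt hz)
    rw [maxArea, this, Real.sSup_empty]

lemma exists_reach_of_lt_maxArea {a : ℝ} (ha : 0 ≤ a) {p : ℝ × ℝ} (h : a < maxArea p) :
    ∃ z, a < z ∧ Reach 1 p.1 p.2 z := by
  have hne : {z | Reach 1 p.1 p.2 z}.Nonempty := by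
    by_contra hne
    rw [Set.not_nonempty_iff_eq_empty] at hne
    rw [maxArea, hne, Real.sSup_empty] at h
    exact h.not_ge ha
  obtain ⟨z, hz, haz⟩ := exists_lt_of_lt_csSup hne h
  exact ⟨z, haz, hz⟩

lemma isOpen_lt_maxArea {a : ℝ} (ha : 0 ≤ a) : IsOpen {p | a < maxArea p} := by
  rw [isOpen_iff_mem_nhds]
  intro p hp
  obtain ⟨z, haz, hz⟩ := exists_reach_of_lt_maxArea ha hp
  obtain ⟨k, m, η, hη, H⟩ := hz.exists_translate
  have h1 : ∀ᶠ q : ℝ × ℝ in nhds p, |q.1 - p.1| + |q.2 - p.2| < η := by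
    refine ContinuousAt.eventually_lt (by fun_prop) continuousAt_const ?_
    simpa using hη
  have h2 : ∀ᶠ q : ℝ × ℝ in nhds p, a < z + k * (q.1 - p.1) + m * (q.2 - p.2) := by
    refine ContinuousAt.eventually_lt continuousAt_const (by fun_prop) ?_
    simpa using haz
  filter_upwards [h1, h2] with q hq1 hq2
  have := H _ _ hq1
  rw [add_sub_cancel, add_sub_cancel] at this
  exact hq2.trans_le this.le_maxArea

lemma measurable_maxArea : Measurable maxArea := by
  refine measurable_of_Ioi fun a => ?_
  rcases le_or_gt 0 a with ha | ha
  · exact (isOpen_lt_maxArea ha).measurableSet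
  · convert MeasurableSet.univ
    exact Set.eq_univ_of_forall fun p => ha.trans_le (maxArea_nonneg p)

lemma isOpen_disc (L : ℝ) : IsOpen (disc L) :=
  isOpen_lt (by fun_prop) continuous_const

lemma volume_disc_lt_top (L : ℝ) : volume (disc L) < ⊤ := by
  refine lt_of_le_of_lt (measure_mono (t := Set.Icc (-L) L ×ˢ Set.Icc (-L) L) ?_)
    (isCompact_Icc.prod isCompact_Icc).measure_lt_top
  intro p hp
  exact ⟨abs_le.1 ((abs_le_sqrt_add_sq_left _ _).trans (le_of_lt hp)),
    abs_le.1 ((abs_le_sqrt_add_sq_right _ _).trans (le_of_lt hp))⟩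

lemma zero_mem_disc {L : ℝ} (hL : 0 < L) : (0 : ℝ × ℝ) ∈ disc L := by simpa [disc] using hL

open Pointwise in
lemma smul_disc {L : ℝ} (hL : 0 < L) : L⁻¹ • disc L = disc 1 := by
  ext p
  rw [Set.mem_inv_smul_set_iff₀ hL.ne']
  simp only [disc, Set.mem_ofPred_eq, Prod.smul_fst, Prod.smul_snd, smul_eq_mul]
  rw [show (L * p.1) ^ 2 + (L * p.2) ^ 2 = L ^ 2 * (p.1 ^ 2 + p.2 ^ 2) by ring,
    Real.sqrt_mul (by positivity), Real.sqrt_sq hL.le]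
  exact mul_lt_iff_lt_one_right hL

lemma exists_reach_iff {L : ℝ} (hL : 0 < L) (x y z : ℝ) :
    (∃ c, |c| < L ∧ Reach L x y (z - c)) ↔
      (x, y) ∈ disc L ∧ |z| < L ^ 2 * maxArea (L⁻¹ • (x, y)) + L := by
  constructor
  · rintro ⟨c, hc, h⟩
    refine ⟨h.sqrt_lt, ?_⟩
    have h1 : Reach L x y |z - c| := h.of_abs_le (abs_abs _).le
    have h2 := h1.smul (inv_pos.2 hL)
    rw [inv_mul_cancel₀ hL.ne'] at h2
    have h3 : L⁻¹ ^ 2 * |z - c| ≤ maxArea (L⁻¹ • (x, y)) := h2.le_maxArea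
    have h4 : |z - c| ≤ L ^ 2 * maxArea (L⁻¹ • (x, y)) := by
      calc |z - c| = L ^ 2 * (L⁻¹ ^ 2 * |z - c|) := by field_simp
        _ ≤ _ := by gcongr
    have h5 : |z| ≤ |z - c| + |c| := by simpa using abs_add_le (z - c) c
    linarith
  · rintro ⟨hxy, hz⟩
    obtain ⟨b, hb0, hzb, hb⟩ : ∃ b, 0 ≤ b ∧ |z| < b + L ∧ Reach L x y b := by
      rcases lt_or_ge |z| L with h | h
      · exact ⟨0, le_rfl, by simpa using h, reach_segment hxy⟩
      · have h1 : 0 ≤ (|z| - L) / L ^ 2 := div_nonneg (by linarith) (by positivity)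
        obtain ⟨s, hs, hr⟩ := exists_reach_of_lt_maxArea (p := L⁻¹ • (x, y)) h1
          (by rw [div_lt_iff₀ (by positivity)]; linarith)
        refine ⟨L ^ 2 * s, by have := h1.trans hs.le; positivity, ?_, ?_⟩
        · rw [div_lt_iff₀ (by positivity)] at hs
          linarith
        · have := hr.smul hL
          simpa [mul_inv_cancel_left₀ hL.ne'] using this
    have hbL : 0 < b + L := by positivity
    have hq : |z| / (b + L) < 1 := (div_lt_one hbL).2 hzb
    refine ⟨z / (b + L) * L, ?_, hb.of_abs_le ?_⟩
    · rw [abs_mul, abs_div, abs_of_pos hbL, abs_of_pos hL]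
      exact mul_lt_of_lt_one_left hL hq
    · rw [show z - z / (b + L) * L = z / (b + L) * b by field_simp; ring, abs_mul, abs_div,
        abs_of_pos hbL]
      exact mul_le_of_le_one_left (abs_nonneg _) hq.le

/-- Half the height of the open Finsler ball of radius `L` over a point of the plane. -/
noncomputable def halfHeight (L : ℝ) (p : ℝ × ℝ) : ℝ := L ^ 2 * maxArea (L⁻¹ • p) + L

lemma measurable_halfHeight (L : ℝ) : Measurable (halfHeight L) :=
  ((measurable_maxArea.comp (measurable_const_smul _)).const_mul _).add_const _

lemma setOf_dFin_lt_eq {L : ℝ} (hL : 0 < L) :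
    {q : Heis | dFin maxNorm 0 q < L} = MeasurableEquiv.prodAssoc.symm ⁻¹'
      regionBetween (fun p => -halfHeight L p) (halfHeight L) (disc L) := by
  ext ⟨x, y, z⟩
  rw [Set.mem_ofPred_eq, dFin_maxNorm_lt_iff, exists_reach_iff hL, abs_lt]
  rfl

lemma measurableSet_setOf_dFin_lt {L : ℝ} (hL : 0 < L) :
    MeasurableSet {q : Heis | dFin maxNorm 0 q < L} := by
  rw [setOf_dFin_lt_eq hL]
  exact MeasurableEquiv.prodAssoc.symm.measurable (measurableSet_regionBetween
    (measurable_halfHeight L).neg (measurable_halfHeight L) (isOpen_disc L).measurableSet)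

lemma integrableOn_maxArea : IntegrableOn maxArea (disc 1) := by
  refine Measure.integrableOn_of_bounded (M := 1) (volume_disc_lt_top 1).ne
    measurable_maxArea.aestronglyMeasurable (Filter.Eventually.of_forall fun p => ?_)
  rw [Real.norm_eq_abs, abs_of_nonneg (maxArea_nonneg p)]
  exact maxArea_le_one p

lemma halfHeight_nonneg {L : ℝ} (hL : 0 < L) (p : ℝ × ℝ) : 0 ≤ halfHeight L p := by
  have := maxArea_nonneg (L⁻¹ • p)
  unfold halfHeight
  positivity

lemma integrableOn_halfHeight {L : ℝ} (hL : 0 < L) : IntegrableOn (halfHeight L) (disc L) := by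
  refine Measure.integrableOn_of_bounded (M := L ^ 2 + L) (volume_disc_lt_top L).ne
    (measurable_halfHeight L).aestronglyMeasurable (Filter.Eventually.of_forall fun p => ?_)
  rw [Real.norm_eq_abs, abs_of_nonneg (halfHeight_nonneg hL p)]
  have := mul_le_of_le_one_right (sq_nonneg L) (maxArea_le_one (L⁻¹ • p))
  unfold halfHeight
  linarith

lemma integral_halfHeight {L : ℝ} (hL : 0 < L) : ∫ p in disc L, halfHeight L p =
    (∫ p in disc 1, maxArea p) * L ^ 4 + volume.real (disc 1) * L ^ 3 := by
  have h := Measure.setIntegral_comp_smul_of_pos volume (fun p => L ^ 2 * maxArea p + L) (disc L)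
    (inv_pos.2 hL)
  have : IsFiniteMeasure (volume.restrict (disc 1)) := ⟨by simpa using volume_disc_lt_top 1⟩
  rw [smul_disc hL, integral_add (integrableOn_maxArea.const_mul _) (integrable_const _),
    MeasureTheory.integral_const_mul, setIntegral_const] at h
  simp only [halfHeight]
  rw [h]
  simp
  ring

lemma volume_setOf_dFin_lt {L : ℝ} (hL : 0 < L) :
    volume {q : Heis | dFin maxNorm 0 q < L} = ENNReal.ofReal
      ((2 * ∫ p in disc 1, maxArea p) * L ^ 4 + 2 * volume.real (disc 1) * L ^ 3) := by
  rw [setOf_dFin_lt_eq hL, (volume_preserving_prodAssoc.symm _).measure_preimage_equiv,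
    Measure.volume_eq_prod, volume_regionBetween_eq_integral
      (f := fun p => -halfHeight L p) (integrableOn_halfHeight hL).neg
      (integrableOn_halfHeight hL) (isOpen_disc L).measurableSet
      (fun p _ => by linarith [halfHeight_nonneg hL p])]
  congr 1
  have : ∀ p, (halfHeight L - fun p => -halfHeight L p) p = 2 * halfHeight L p := by
    intro p
    simp only [Pi.sub_apply]
    ring
  simp only [this]
  rw [MeasureTheory.integral_const_mul, integral_halfHeight hL]
  ring

lemma integral_maxArea_pos : 0 < ∫ p in disc 1, maxArea p := by
  rw [setIntegral_pos_iff_support_of_nonneg_ae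
    (Filter.Eventually.of_forall maxArea_nonneg) integrableOn_maxArea]
  obtain ⟨z, hz, hr⟩ := exists_reach_zero_zero_pos
  refine lt_of_lt_of_le (IsOpen.measure_pos volume ((isOpen_lt_maxArea le_rfl).inter
    (isOpen_disc 1)) ⟨0, hz.trans_le hr.le_maxArea, zero_mem_disc one_pos⟩) (measure_mono ?_)
  exact Set.inter_subset_inter_left _ fun p hp => ne_of_gt hp

lemma volume_real_disc_pos : 0 < volume.real (disc 1) :=
  ENNReal.toReal_pos ((isOpen_disc 1).measure_pos volume ⟨0, zero_mem_disc one_pos⟩).ne'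
    (volume_disc_lt_top 1).ne

lemma volume_setOf_dFin_le {r : ℝ} (hr : 0 ≤ r) :
    volume {q : Heis | dFin maxNorm 0 q ≤ r} = ENNReal.ofReal
      ((2 * ∫ p in disc 1, maxArea p) * r ^ 4 + 2 * volume.real (disc 1) * r ^ 3) := by
  have hpos : ∀ n : ℕ, 0 < r + 1 / ((n : ℝ) + 1) := fun n => by positivity
  have hlim : Filter.Tendsto (fun n : ℕ => r + 1 / ((n : ℝ) + 1)) Filter.atTop (nhds r) := by
    simpa using tendsto_one_div_add_atTop_nhds_zero_nat.const_add r
  have hset : {q : Heis | dFin maxNorm 0 q ≤ r} =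
      ⋂ n : ℕ, {q : Heis | dFin maxNorm 0 q < r + 1 / ((n : ℝ) + 1)} := by
    ext q
    simp only [Set.mem_ofPred_eq, Set.mem_iInter]
    refine ⟨fun h n => h.trans_lt (by linarith [show 0 < 1 / ((n : ℝ) + 1) by positivity]),
      fun h => ge_of_tendsto' hlim fun n => (h n).le⟩
  have h1 := tendsto_measure_iInter_atTop (μ := volume)
    (s := fun n : ℕ => {q : Heis | dFin maxNorm 0 q < r + 1 / ((n : ℝ) + 1)})
    (fun n => (measurableSet_setOf_dFin_lt (hpos n)).nullMeasurableSet)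
    (fun m n hmn q hq => lt_of_lt_of_le (Set.mem_ofPred_eq ▸ hq)
      (by gcongr))
    ⟨0, by rw [volume_setOf_dFin_lt (hpos 0)]; exact ENNReal.ofReal_ne_top⟩
  rw [hset]
  refine tendsto_nhds_unique h1 ?_
  simp only [Function.comp_def, volume_setOf_dFin_lt (hpos _)]
  exact ENNReal.tendsto_ofReal (((hlim.pow 4).const_mul _).add ((hlim.pow 3).const_mul _))

/-- for the `ℓ^∞`-type norm `‖u‖ = max(√(u₁²+u₂²), |u₃|)`, the Lebesgue
volume of the closed `d_F`-ball of radius `r` equals `C·r⁴ + D·r³` for every `r ≥ 0`. -/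
theorem stmt_16 :
    ∃ C > (0:ℝ), ∃ D > (0:ℝ), ∀ r : ℝ, 0 ≤ r →
      volume {q : Heis |
          dFin (fun u => max (Real.sqrt (u.1 ^ 2 + u.2.1 ^ 2)) |u.2.2|) 0 q ≤ r} =
        ENNReal.ofReal (C * r ^ 4 + D * r ^ 3) := by
  exact ⟨2 * ∫ p in disc 1, maxArea p, mul_pos two_pos integral_maxArea_pos,
    2 * volume.real (disc 1), mul_pos two_pos volume_real_disc_pos,
    fun r hr => volume_setOf_dFin_le hr⟩
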